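/- Ramanujan's product formula for the g-invariant: for every real r > 0, ∏_{j=0}^∞ (1 − exp(−(2j+1)·π·√r)) = 2^{1/4} · exp(−π·√r/24) · g_r, where the infinite product over the odd positive integers 2j+1 converges. -/

import Mathlib

open Real Filter

/-- The one-variable Jacobi theta function `θ₂(q) = ∑_{n ∈ ℤ} q^((n + 1/2)²)`. -/
noncomputable def theta2 (q : ℝ) : ℝ := ∑' n : ℤ, q ^ (((n : ℝ) + 1 / 2) ^ 2)

/-- The one-variable Jacobi theta function `θ₃(q) = ∑_{n ∈ ℤ} q^(n²)`. -/
noncomputable def theta3 (q : ℝ) : ℝ := ∑' n : ℤ, q ^ ((n : ℝ) ^ 2)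

/-- The singular value `k_r = λ*(r) = θ₂(q)²/θ₃(q)²` with `q = exp(−π√r)`. -/
noncomputable def kSing (r : ℝ) : ℝ :=
  theta2 (Real.exp (-(π * Real.sqrt r))) ^ 2 / theta3 (Real.exp (-(π * Real.sqrt r))) ^ 2

/-- The Ramanujan g-invariant `g_r = ((1 − k_r²)/(2 k_r))^(1/12)`. -/
noncomputable def gRam (r : ℝ) : ℝ := ((1 - kSing r ^ 2) / (2 * kSing r)) ^ ((1 : ℝ) / 12)

open Topology Finset

/-! ### The infinite product `∏ (1 + a q ^ j)` -/

/-- The infinite `q`-Pochhammer product `∏_{j ≥ 0} (1 + a q ^ j)`. -/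
noncomputable def eulerProd (a q : ℝ) : ℝ := ∏' j : ℕ, (1 + a * q ^ j)

section EulerProd

variable {q : ℝ}

lemma summable_norm_mul_pow (hq0 : 0 < q) (hq1 : q < 1) (a : ℝ) :
    Summable fun j : ℕ => ‖a * q ^ j‖ :=
  ((summable_geometric_of_lt_one hq0.le hq1).mul_left a).norm

lemma multipliable_eulerProd (hq0 : 0 < q) (hq1 : q < 1) (a : ℝ) :
    Multipliable fun j : ℕ => 1 + a * q ^ j :=
  multipliable_one_add_of_summable (summable_norm_mul_pow hq0 hq1 a)

lemma tendsto_prod_eulerProd (hq0 : 0 < q) (hq1 : q < 1) (a : ℝ) :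
    Tendsto (fun n => ∏ j ∈ range n, (1 + a * q ^ j)) atTop (𝓝 (eulerProd a q)) :=
  (multipliable_eulerProd hq0 hq1 a).hasProd.tendsto_prod_nat

lemma one_add_mul_pow_pos (hq0 : 0 < q) (hq1 : q < 1) {a : ℝ} (ha : -1 < a) (j : ℕ) :
    0 < 1 + a * q ^ j := by
  have h0 : 0 < q ^ j := by positivity
  have h1 : q ^ j ≤ 1 := pow_le_one₀ hq0.le hq1.le
  nlinarith

lemma eulerProd_pos (hq0 : 0 < q) (hq1 : q < 1) {a : ℝ} (ha : -1 < a) : 0 < eulerProd a q := by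
  refine lt_of_le_of_ne ?_ (Ne.symm ?_)
  · exact ge_of_tendsto' (tendsto_prod_eulerProd hq0 hq1 a) fun n =>
      prod_nonneg fun j _ => (one_add_mul_pow_pos hq0 hq1 ha j).le
  · exact tprod_one_add_ne_zero_of_summable
      (fun j => (one_add_mul_pow_pos hq0 hq1 ha j).ne') (summable_norm_mul_pow hq0 hq1 a)

lemma eulerProd_le_prod (hq0 : 0 < q) (hq1 : q < 1) {a : ℝ} (ha : -1 < a) (ha0 : a ≤ 0) (n : ℕ) :
    eulerProd a q ≤ ∏ j ∈ range n, (1 + a * q ^ j) := by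
  have hanti : Antitone fun n => ∏ j ∈ range n, (1 + a * q ^ j) := by
    refine antitone_nat_of_succ_le fun n => ?_
    rw [prod_range_succ]
    refine mul_le_of_le_one_right
      (prod_nonneg fun j _ => (one_add_mul_pow_pos hq0 hq1 ha j).le) ?_
    have h0 : 0 < q ^ n := by positivity
    nlinarith
  exact hanti.le_of_tendsto (tendsto_prod_eulerProd hq0 hq1 a) n

lemma eulerProd_eq_mul_shift (hq0 : 0 < q) (hq1 : q < 1) (a : ℝ) :
    eulerProd a q = (1 + a) * eulerProd (a * q) q := by
  have h : ∀ j : ℕ, 1 + a * q ^ (j + 1) = 1 + a * q * q ^ j := fun j => by ring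
  unfold eulerProd
  rw [tprod_eq_zero_mul' (by simpa only [h] using multipliable_eulerProd hq0 hq1 (a * q))]
  simp only [h, pow_zero, mul_one]

lemma eulerProd_eq_even_mul_odd (hq0 : 0 < q) (hq1 : q < 1) (a : ℝ) :
    eulerProd a q = eulerProd a (q ^ 2) * eulerProd (a * q) (q ^ 2) := by
  have hs0 : 0 < q ^ 2 := by positivity
  have hs1 : q ^ 2 < 1 := pow_lt_one₀ hq0.le hq1 two_ne_zero
  have he : ∀ j : ℕ, 1 + a * q ^ (2 * j) = 1 + a * (q ^ 2) ^ j := fun j => by ring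
  have ho : ∀ j : ℕ, 1 + a * q ^ (2 * j + 1) = 1 + a * q * (q ^ 2) ^ j := fun j => by ring
  unfold eulerProd
  rw [← tprod_even_mul_odd (f := fun j => 1 + a * q ^ j)
    (by simpa only [he] using multipliable_eulerProd hs0 hs1 a)
    (by simpa only [ho] using multipliable_eulerProd hs0 hs1 (a * q))]
  simp only [he, ho]

lemma eulerProd_mul_eulerProd_neg (hq0 : 0 < q) (hq1 : q < 1) (a : ℝ) :
    eulerProd a q * eulerProd (-a) q = eulerProd (-a ^ 2) (q ^ 2) := by
  unfold eulerProd
  rw [← (multipliable_eulerProd hq0 hq1 a).tprod_mul (multipliable_eulerProd hq0 hq1 (-a))]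
  exact tprod_congr fun j => by ring

/-- The Euler identity `∏ (1 - q ^ (2j+1)) ∏ (1 + q ^ (j+1)) = 1`. -/
lemma eulerProd_odd_mul_eulerProd (hq0 : 0 < q) (hq1 : q < 1) :
    eulerProd (-q) (q ^ 2) * (eulerProd q (q ^ 2) * eulerProd (q ^ 2) (q ^ 2)) = 1 := by
  have hs1 : q ^ 2 < 1 := pow_lt_one₀ hq0.le hq1 two_ne_zero
  have hR : 0 < eulerProd (-q ^ 2) (q ^ 2) := eulerProd_pos (by positivity) hs1 (by linarith)
  have h := eulerProd_mul_eulerProd_neg hq0 hq1 q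
  rw [eulerProd_eq_even_mul_odd hq0 hq1 q, eulerProd_eq_even_mul_odd hq0 hq1 (-q),
    show -q * q = -q ^ 2 by ring, show q * q = q ^ 2 by ring] at h
  apply mul_right_cancel₀ hR.ne'
  linarith

end EulerProd

/-! ### The finite `q`-binomial theorem -/

/-- The `q`-binomial theorem, normalised by `q`-factorials. -/
lemma sum_antidiagonal_qbinomial {Q : ℝ} (hQ0 : 0 < Q) (hQ1 : Q < 1) (x : ℝ) (M : ℕ) :
    ∑ p ∈ antidiagonal M, (Q ^ (p.1.choose 2) * x ^ p.1 / ∏ j ∈ range p.1, (1 + -Q * Q ^ j)) *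
        (∏ j ∈ range p.2, (1 + -Q * Q ^ j))⁻¹ =
      (∏ j ∈ range M, (1 + x * Q ^ j)) / ∏ j ∈ range M, (1 + -Q * Q ^ j) := by
  have hfac : ∀ j : ℕ, 1 + -Q * Q ^ j ≠ 0 := fun j =>
    (one_add_mul_pow_pos hQ0 hQ1 (by linarith) j).ne'
  have hprod : ∀ m : ℕ, ∏ j ∈ range m, (1 + -Q * Q ^ j) ≠ 0 := fun m =>
    prod_ne_zero_iff.mpr fun j _ => hfac j
  set b : ℕ → ℝ := fun m => (∏ j ∈ range m, (1 + -Q * Q ^ j))⁻¹ with hb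
  set e : ℕ → ℝ := fun k => Q ^ (k.choose 2) * x ^ k / ∏ j ∈ range k, (1 + -Q * Q ^ j) with he
  have hb_succ : ∀ m, (1 - Q ^ (m + 1)) * b (m + 1) = b m := fun m => by
    have := hfac m
    simp only [hb, prod_range_succ, mul_inv]
    rw [show 1 - Q ^ (m + 1) = 1 + -Q * Q ^ m by ring, mul_comm, inv_mul_cancel_right₀ this]
  have he_succ : ∀ k, (1 - Q ^ (k + 1)) * e (k + 1) = x * Q ^ k * e k := fun k => by
    have := hfac k
    simp only [he, prod_range_succ, Nat.choose_succ_succ' k 1, Nat.choose_one_right]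
    rw [show 1 - Q ^ (k + 1) = 1 + -Q * Q ^ k by ring]
    have hP := hprod k
    generalize 1 + -Q * Q ^ k = F at *
    generalize ∏ j ∈ range k, (1 + -Q * Q ^ j) = P at *
    field_simp
    ring
  change ∑ p ∈ antidiagonal M, e p.1 * b p.2 = _
  induction M with
  | zero => simp [e, b]
  | succ M ih =>
    have key : (1 - Q ^ (M + 1)) * ∑ p ∈ antidiagonal (M + 1), e p.1 * b p.2 =
        (1 + x * Q ^ M) * ∑ p ∈ antidiagonal M, e p.1 * b p.2 := by
      have h1 : ∑ p ∈ antidiagonal (M + 1), (1 - Q ^ p.2) * (e p.1 * b p.2) =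
          ∑ p ∈ antidiagonal M, e p.1 * b p.2 := by
        rw [Finset.Nat.sum_antidiagonal_succ']
        simp only [pow_zero, sub_self, zero_mul, zero_add]
        exact sum_congr rfl fun p _ => by rw [← hb_succ p.2]; ring
      have h2 : ∑ p ∈ antidiagonal (M + 1), Q ^ p.2 * (1 - Q ^ p.1) * (e p.1 * b p.2) =
          x * Q ^ M * ∑ p ∈ antidiagonal M, e p.1 * b p.2 := by
        rw [Finset.Nat.sum_antidiagonal_succ, mul_sum]
        simp only [pow_zero, sub_self, zero_mul, mul_zero, zero_add]
        refine sum_congr rfl fun p hp => ?_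
        rw [← mem_antidiagonal.mp hp, pow_add]
        linear_combination (Q ^ p.2 * b p.2) * he_succ p.1
      rw [one_add_mul, ← h2, ← h1, ← sum_add_distrib, mul_sum]
      refine sum_congr rfl fun p hp => ?_
      rw [← mem_antidiagonal.mp hp, pow_add]
      ring
    have hM := hfac M
    rw [ih, show 1 - Q ^ (M + 1) = 1 + -Q * Q ^ M by ring] at key
    rw [prod_range_succ, prod_range_succ]
    rw [eq_div_iff (mul_ne_zero (hprod M) hM)]
    rw [mul_div_assoc', eq_div_iff (hprod M)] at key
    linarith

/-! ### The Jacobi triple product -/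

/-- The two-variable theta series `∑_{n ∈ ℤ} q ^ n² z ^ n`. -/
noncomputable def thetaSeries (q z : ℝ) : ℝ := ∑' n : ℤ, q ^ (n ^ 2) * z ^ n

lemma summable_thetaSeries {q z : ℝ} (hq0 : 0 < q) (hq1 : q < 1) (hz : z ≠ 0) :
    Summable fun n : ℤ => q ^ (n ^ 2) * z ^ n := by
  have hnat : ∀ w : ℝ, w ≠ 0 → Summable fun n : ℕ => q ^ (n ^ 2) * w ^ n := fun w hw => by
    refine summable_of_ratio_test_tendsto_lt_one (l := 0) zero_lt_one
      (Eventually.of_forall fun n => by positivity) ?_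
    have hlim : Tendsto (fun n : ℕ => (q ^ 2) ^ n * (q * |w|)) atTop (𝓝 0) := by
      simpa using (tendsto_pow_atTop_nhds_zero_of_lt_one (by positivity)
        (pow_lt_one₀ hq0.le hq1 two_ne_zero)).mul_const (q * |w|)
    refine hlim.congr fun n => ?_
    have hw' : |w| ≠ 0 := abs_ne_zero.mpr hw
    simp only [norm_mul, norm_pow, Real.norm_eq_abs, abs_of_pos hq0]
    rw [eq_div_iff (by positivity)]
    ring
  refine .of_nat_of_neg ((hnat z hz).congr fun n => ?_)
    ((hnat z⁻¹ (inv_ne_zero hz)).congr fun n => ?_)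
  · rw [← Nat.cast_pow, zpow_natCast, zpow_natCast]
  · rw [neg_sq, ← Nat.cast_pow, zpow_natCast, zpow_neg, zpow_natCast, inv_pow]

/-- The reciprocal `q`-factorial, extended by zero to negative integers. -/
noncomputable def qFactorialInv (Q : ℝ) (m : ℤ) : ℝ :=
  if m < 0 then 0 else (∏ j ∈ range m.toNat, (1 + -Q * Q ^ j))⁻¹

lemma abs_qFactorialInv_le {Q : ℝ} (hQ0 : 0 < Q) (hQ1 : Q < 1) (m : ℤ) :
    |qFactorialInv Q m| ≤ (eulerProd (-Q) Q)⁻¹ := by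
  have hR : 0 < eulerProd (-Q) Q := eulerProd_pos hQ0 hQ1 (by linarith)
  unfold qFactorialInv
  split_ifs
  · simpa using hR.le
  · have h := eulerProd_le_prod hQ0 hQ1 (a := -Q) (by linarith) (by linarith) m.toNat
    rw [abs_of_pos (inv_pos.mpr (hR.trans_le h))]
    exact inv_anti₀ hR h

lemma tendsto_qFactorialInv {Q : ℝ} (hQ0 : 0 < Q) (hQ1 : Q < 1) :
    Tendsto (qFactorialInv Q) atTop (𝓝 (eulerProd (-Q) Q)⁻¹) := by
  have hR : 0 < eulerProd (-Q) Q := eulerProd_pos hQ0 hQ1 (by linarith)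
  have h := ((tendsto_prod_eulerProd hQ0 hQ1 (-Q)).inv₀ hR.ne').comp
    (tendsto_natCast_atTop_iff.mp (tendsto_atTop_mono Int.self_le_toNat tendsto_id))
  refine h.congr' ?_
  filter_upwards [eventually_ge_atTop 0] with m hm
  simp [qFactorialInv, not_lt.mpr hm]

/-- The finite form of the Jacobi triple product. -/
lemma tsum_thetaSeries_finite {q z : ℝ} (hq0 : 0 < q) (hq1 : q < 1) (hz : z ≠ 0) (N : ℕ) :
    ∑' n : ℤ, q ^ (n ^ 2) * z ^ n * (qFactorialInv (q ^ 2) (N + n) * qFactorialInv (q ^ 2) (N - n)) =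
      (∏ j ∈ range N, (1 + z * q * (q ^ 2) ^ j)) * (∏ j ∈ range N, (1 + z⁻¹ * q * (q ^ 2) ^ j)) /
        ∏ j ∈ range (2 * N), (1 + -q ^ 2 * (q ^ 2) ^ j) := by
  have hs0 : 0 < q ^ 2 := by positivity
  have hs1 : q ^ 2 < 1 := pow_lt_one₀ hq0.le hq1 two_ne_zero
  have hq : q ≠ 0 := hq0.ne'
  have hinj : Function.Injective fun k : ℕ => (k : ℤ) - N := fun a b h => by
    simpa using h
  have hprod : ∏ j ∈ range (2 * N), (1 + z * q ^ (1 - 2 * (N : ℤ)) * (q ^ 2) ^ j) =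
      z ^ N * q ^ (-(N : ℤ) ^ 2) * ((∏ j ∈ range N, (1 + z * q * (q ^ 2) ^ j)) *
        ∏ j ∈ range N, (1 + z⁻¹ * q * (q ^ 2) ^ j)) := by
    have hlow : ∏ j ∈ range N, (1 + z * q ^ (1 - 2 * (N : ℤ)) * (q ^ 2) ^ j) =
        z ^ N * q ^ (-(N : ℤ) ^ 2) * ∏ j ∈ range N, (1 + z⁻¹ * q * (q ^ 2) ^ j) := by
      have hfac : ∀ i ∈ range N, 1 + z * q ^ (1 - 2 * (N : ℤ)) * (q ^ 2) ^ (N - 1 - i) =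
          z * q ^ (-(2 * (i : ℤ) + 1)) * (1 + z⁻¹ * q * (q ^ 2) ^ i) := fun i hi => by
        have hi' : i + 1 ≤ N := mem_range.mp hi
        obtain ⟨d, rfl⟩ := Nat.exists_eq_add_of_le hi'
        rw [show i + 1 + d - 1 - i = d by omega, ← pow_mul, ← pow_mul, ← zpow_natCast,
          ← zpow_natCast, mul_assoc z, ← zpow_add₀ hq, mul_one_add]
        have h1 : (1 - 2 * ((i + 1 + d : ℕ) : ℤ) + ((2 * d : ℕ) : ℤ)) = -(2 * (i : ℤ) + 1) := by
          push_cast; ring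
        have h2 : z * q ^ (-(2 * (i : ℤ) + 1)) * (z⁻¹ * q * q ^ ((2 * i : ℕ) : ℤ)) = 1 := by
          rw [zpow_neg, zpow_add₀ hq, zpow_one]
          push_cast
          field_simp
        rw [h1, h2]
        ring
      have hsum : ∏ i ∈ range N, (z * q ^ (-(2 * (i : ℤ) + 1))) = z ^ N * q ^ (-(N : ℤ) ^ 2) := by
        clear hfac hinj
        induction N with
        | zero => simp
        | succ N ih =>
          rw [prod_range_succ, ih, mul_mul_mul_comm, ← zpow_add₀ hq, ← pow_succ]
          congr 2
          push_cast
          ring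
      rw [← prod_range_reflect, prod_congr rfl hfac, prod_mul_distrib, hsum]
    have hhigh : ∀ j : ℕ, 1 + z * q ^ (1 - 2 * (N : ℤ)) * (q ^ 2) ^ (N + j) =
        1 + z * q * (q ^ 2) ^ j := fun j => by
      rw [pow_add, ← pow_mul, ← zpow_natCast q (2 * N), mul_assoc, ← mul_assoc (q ^ _),
        ← zpow_add₀ hq]
      push_cast
      simp [mul_assoc]
    rw [two_mul, prod_range_add, hlow, prod_congr rfl fun j _ => hhigh j]
    ring
  have hbin := sum_antidiagonal_qbinomial hs0 hs1 (z * q ^ (1 - 2 * (N : ℤ))) (2 * N)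
  rw [hprod, Finset.Nat.sum_antidiagonal_eq_sum_range_succ_mk] at hbin
  rw [tsum_eq_sum (s := (range (2 * N + 1)).image fun k : ℕ => (k : ℤ) - N), sum_image hinj.injOn]
  · have hc : z ^ N * q ^ (-(N : ℤ) ^ 2) ≠ 0 := by positivity
    apply mul_left_cancel₀ hc
    rw [← mul_div_assoc, ← hbin, mul_sum]
    refine sum_congr rfl fun k hk => ?_
    have hk' : k ≤ 2 * N := Nat.lt_succ_iff.mp (mem_range.mp hk)
    have hA : qFactorialInv (q ^ 2) (N + ((k : ℤ) - N)) =
        (∏ j ∈ range k, (1 + -q ^ 2 * (q ^ 2) ^ j))⁻¹ := by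
      simp [qFactorialInv]
    have hB : qFactorialInv (q ^ 2) (N - ((k : ℤ) - N)) =
        (∏ j ∈ range (2 * N - k), (1 + -q ^ 2 * (q ^ 2) ^ j))⁻¹ := by
      rw [show (N : ℤ) - ((k : ℤ) - N) = ((2 * N - k : ℕ) : ℤ) by push_cast [hk']; ring]
      simp [qFactorialInv]
    have hpow : (q ^ 2) ^ (k.choose 2) * (z * q ^ (1 - 2 * (N : ℤ))) ^ k =
        z ^ N * q ^ (-(N : ℤ) ^ 2) * (q ^ (((k : ℤ) - N) ^ 2) * z ^ ((k : ℤ) - N)) := by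
      have hch : 2 * k.choose 2 = k * (k - 1) := by
        rw [Nat.choose_two_right, Nat.mul_div_cancel' (Nat.even_mul_pred_self k).two_dvd]
      have hch' : ((k * (k - 1) : ℕ) : ℤ) = (k : ℤ) * k - k := by
        cases k <;> simp; ring
      rw [← pow_mul, hch, mul_pow, ← zpow_natCast q, hch', ← zpow_natCast (q ^ _), ← zpow_mul,
        zpow_sub₀ hz, zpow_natCast z, zpow_natCast z]
      have e : (k : ℤ) * k - k + (1 - 2 * (N : ℤ)) * k = -(N : ℤ) ^ 2 + ((k : ℤ) - N) ^ 2 := by ring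
      have e' : q ^ ((k : ℤ) * k - k) * q ^ ((1 - 2 * (N : ℤ)) * k) =
          q ^ (-(N : ℤ) ^ 2) * q ^ (((k : ℤ) - N) ^ 2) := by
        rw [← zpow_add₀ hq, ← zpow_add₀ hq, e]
      field_simp
      linear_combination e'
    rw [hA, hB, hpow]
    ring
  · intro n hn
    have : (N : ℤ) + n < 0 ∨ (N : ℤ) - n < 0 := by
      by_contra! h
      refine hn (mem_image.mpr ⟨(N + n).toNat, mem_range.mpr ?_, ?_⟩) <;> omega
    rcases this with h | h <;> simp [qFactorialInv, h]

/-- The Jacobi triple product identity. -/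
theorem thetaSeries_eq_eulerProd {q z : ℝ} (hq0 : 0 < q) (hq1 : q < 1) (hz : z ≠ 0) :
    thetaSeries q z =
      eulerProd (-q ^ 2) (q ^ 2) * (eulerProd (z * q) (q ^ 2) * eulerProd (z⁻¹ * q) (q ^ 2)) := by
  have hs0 : 0 < q ^ 2 := by positivity
  have hs1 : q ^ 2 < 1 := pow_lt_one₀ hq0.le hq1 two_ne_zero
  have hR : 0 < eulerProd (-q ^ 2) (q ^ 2) := eulerProd_pos hs0 hs1 (by linarith)
  have hcast : Tendsto (fun N : ℕ => (N : ℤ)) atTop atTop := tendsto_natCast_atTop_atTop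
  have hleft := tendsto_tsum_of_dominated_convergence (𝓕 := atTop)
    (f := fun (N : ℕ) (n : ℤ) => q ^ (n ^ 2) * z ^ n *
      (qFactorialInv (q ^ 2) (N + n) * qFactorialInv (q ^ 2) (N - n)))
    (g := fun n => q ^ (n ^ 2) * z ^ n *
      ((eulerProd (-q ^ 2) (q ^ 2))⁻¹ * (eulerProd (-q ^ 2) (q ^ 2))⁻¹))
    ((summable_thetaSeries hq0 hq1 hz).norm.mul_right
      ((eulerProd (-q ^ 2) (q ^ 2))⁻¹ * (eulerProd (-q ^ 2) (q ^ 2))⁻¹))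
    (fun n => ((((tendsto_qFactorialInv hs0 hs1).comp
      (tendsto_atTop_add_const_right _ n hcast)).mul ((tendsto_qFactorialInv hs0 hs1).comp
      (tendsto_atTop_add_const_right _ (-n) hcast))).const_mul _))
    (Eventually.of_forall fun N n => by
      rw [norm_mul, norm_mul (qFactorialInv _ _)]
      gcongr <;> exact abs_qFactorialInv_le hs0 hs1 _)
  have hright := ((tendsto_prod_eulerProd hs0 hs1 (z * q)).mul
    (tendsto_prod_eulerProd hs0 hs1 (z⁻¹ * q))).div
    ((tendsto_prod_eulerProd hs0 hs1 (-q ^ 2)).comp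
      (tendsto_id.const_mul_atTop' (two_pos : 0 < (2 : ℕ)))) hR.ne'
  have h := tendsto_nhds_unique hleft
    (hright.congr fun N => (tsum_thetaSeries_finite hq0 hq1 hz N).symm)
  rw [tsum_mul_right] at h
  change thetaSeries q z * _ = _ at h
  rw [eq_div_iff hR.ne', mul_assoc, mul_assoc, inv_mul_cancel₀ hR.ne', mul_one, ← div_eq_mul_inv,
    div_eq_iff hR.ne'] at h
  rw [h, mul_comm]

/-! ### The Jacobi quartic identity -/

/-- The partition of the square lattice according to the parity of the sum of coordinates. -/
noncomputable def latticeParityEquiv : (ℤ × ℤ) ⊕ (ℤ × ℤ) ≃ ℤ × ℤ :=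
  Equiv.ofBijective
    (Sum.elim (fun p => (p.1 + p.2, p.1 - p.2)) (fun p => (p.1 + p.2 + 1, p.1 - p.2))) (by
      constructor
      · rintro (⟨a, b⟩ | ⟨a, b⟩) (⟨c, d⟩ | ⟨c, d⟩) h <;>
          simp only [Sum.elim_inl, Sum.elim_inr, Prod.mk.injEq] at h
        · rw [show a = c by omega, show b = d by omega]
        · omega
        · omega
        · rw [show a = c by omega, show b = d by omega]
      · rintro ⟨m, n⟩
        rcases Int.even_or_odd' (m + n) with ⟨a, h | h⟩
        · exact ⟨.inl (a, m - a), by simp only [Sum.elim_inl, Prod.mk.injEq]; omega⟩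
        · exact ⟨.inr (a, m - a - 1), by simp only [Sum.elim_inr, Prod.mk.injEq]; omega⟩)

lemma thetaSeries_mul_thetaSeries {q z w : ℝ} (hq0 : 0 < q) (hq1 : q < 1) (hz : z ≠ 0)
    (hw : w ≠ 0) :
    thetaSeries q z * thetaSeries q w =
      thetaSeries (q ^ 2) (z * w) * thetaSeries (q ^ 2) (z / w) +
        q * z * (thetaSeries (q ^ 2) (q ^ 2 * (z * w)) *
          thetaSeries (q ^ 2) (q ^ 2 * (z / w))) := by
  have hs0 : 0 < q ^ 2 := by positivity
  have hs1 : q ^ 2 < 1 := pow_lt_one₀ hq0.le hq1 two_ne_zero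
  have hq : q ≠ 0 := hq0.ne'
  have hmul : ∀ {t u v : ℝ}, 0 < t → t < 1 → u ≠ 0 → v ≠ 0 →
      thetaSeries t u * thetaSeries t v =
        ∑' p : ℤ × ℤ, (t ^ (p.1 ^ 2) * u ^ p.1) * (t ^ (p.2 ^ 2) * v ^ p.2) :=
    fun ht0 ht1 hu hv => tsum_mul_tsum_of_summable_norm
      (summable_thetaSeries ht0 ht1 hu).norm (summable_thetaSeries ht0 ht1 hv).norm
  have hsum : Summable fun p : ℤ × ℤ => (q ^ (p.1 ^ 2) * z ^ p.1) * (q ^ (p.2 ^ 2) * w ^ p.2) :=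
    summable_mul_of_summable_norm
      (summable_thetaSeries hq0 hq1 hz).norm (summable_thetaSeries hq0 hq1 hw).norm
  have hsum' := latticeParityEquiv.summable_iff.mpr hsum
  rw [hmul hq0 hq1 hz hw, hmul hs0 hs1 (by positivity) (by positivity),
    hmul hs0 hs1 (by positivity) (by positivity), ← latticeParityEquiv.tsum_eq]
  rw [Summable.tsum_sum (f := fun c => q ^ (latticeParityEquiv c).1 ^ 2 *
      z ^ (latticeParityEquiv c).1 * (q ^ (latticeParityEquiv c).2 ^ 2 *
      w ^ (latticeParityEquiv c).2)) (hsum'.comp_injective Sum.inl_injective)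
      (hsum'.comp_injective Sum.inr_injective), ← tsum_mul_left]
  congr 1
  · refine tsum_congr fun ⟨a, b⟩ => ?_
    change (q ^ ((a + b) ^ 2) * z ^ (a + b)) * (q ^ ((a - b) ^ 2) * w ^ (a - b)) = _
    have e : q ^ ((a + b) ^ 2) * q ^ ((a - b) ^ 2) = (q ^ 2) ^ (a ^ 2) * (q ^ 2) ^ (b ^ 2) := by
      rw [← zpow_natCast q 2, ← zpow_mul, ← zpow_mul, ← zpow_add₀ hq, ← zpow_add₀ hq]
      congr 1
      push_cast
      ring
    rw [mul_zpow, div_zpow, zpow_add₀ hz, zpow_sub₀ hw]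
    linear_combination (z ^ a * z ^ b * (w ^ a / w ^ b)) * e
  · refine tsum_congr fun ⟨a, b⟩ => ?_
    change (q ^ ((a + b + 1) ^ 2) * z ^ (a + b + 1)) * (q ^ ((a - b) ^ 2) * w ^ (a - b)) = _
    have e : q ^ ((a + b + 1) ^ 2) * q ^ ((a - b) ^ 2) =
        q * ((q ^ 2) ^ (a ^ 2) * (q ^ 2) ^ a * ((q ^ 2) ^ (b ^ 2) * (q ^ 2) ^ b)) := by
      rw [← zpow_natCast q 2]
      simp only [← zpow_mul, ← zpow_add₀ hq]
      rw [← zpow_one_add₀ hq]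
      congr 1
      push_cast
      ring
    rw [mul_zpow, mul_zpow, mul_zpow, div_zpow, zpow_add₀ hz, zpow_add₀ hz, zpow_sub₀ hw, zpow_one]
    linear_combination (z ^ a * z ^ b * z * (w ^ a / w ^ b)) * e

lemma thetaSeries_sq_mul {q z : ℝ} (hq0 : 0 < q) (hz : z ≠ 0) :
    q * z * thetaSeries q (q ^ 2 * z) = thetaSeries q z := by
  unfold thetaSeries
  rw [← tsum_mul_left, ← (Equiv.addRight (1 : ℤ)).tsum_eq fun n : ℤ => q ^ (n ^ 2) * z ^ n]
  refine tsum_congr fun n => ?_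
  have hq : q ≠ 0 := hq0.ne'
  rw [Equiv.coe_addRight, mul_zpow, zpow_add₀ hz, zpow_one, ← zpow_natCast q 2, ← zpow_mul,
    show (n + 1) ^ 2 = 1 + n ^ 2 + (2 : ℕ) * n by push_cast; ring, zpow_add₀ hq, zpow_add₀ hq,
    zpow_one]
  ring

/-- The Jacobi identity `θ₃⁴ = θ₂⁴ + θ₄⁴`. -/
theorem thetaSeries_quartic {q : ℝ} (hq0 : 0 < q) (hq1 : q < 1) :
    thetaSeries q 1 ^ 4 = q * thetaSeries q q ^ 4 + thetaSeries q (-1) ^ 4 := by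
  have h3 := thetaSeries_mul_thetaSeries hq0 hq1 one_ne_zero one_ne_zero
  have h4 := thetaSeries_mul_thetaSeries hq0 hq1 (neg_ne_zero.mpr one_ne_zero)
    (neg_ne_zero.mpr (one_ne_zero (α := ℝ)))
  have h2 := thetaSeries_mul_thetaSeries hq0 hq1 hq0.ne' hq0.ne'
  have hshift := thetaSeries_sq_mul (q := q ^ 2) (z := 1) (by positivity) one_ne_zero
  rw [div_self hq0.ne', show q ^ 2 * (q * q) = (q ^ 2) ^ 2 * 1 by ring,
    show q * q = q ^ 2 by ring] at h2
  norm_num at h2 h3 h4 hshift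
  set A := thetaSeries (q ^ 2) 1
  set B := thetaSeries (q ^ 2) (q ^ 2)
  have h2' : thetaSeries q q ^ 2 = 2 * (A * B) := by
    linear_combination h2 + B * hshift
  rw [show thetaSeries q q ^ 4 = (thetaSeries q q ^ 2) ^ 2 by ring, h2',
    show thetaSeries q 1 ^ 4 = (thetaSeries q 1 * thetaSeries q 1) ^ 2 by ring,
    show thetaSeries q (-1) ^ 4 = (thetaSeries q (-1) * thetaSeries q (-1)) ^ 2 by ring, h3, h4]
  ring

/-! ### The theta constants and the `g`-invariant -/

lemma theta3_eq_thetaSeries (q : ℝ) : theta3 q = thetaSeries q 1 := by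
  refine tsum_congr fun n => ?_
  rw [one_zpow, mul_one, ← Real.rpow_intCast]
  push_cast
  rfl

lemma theta2_eq_thetaSeries {q : ℝ} (hq0 : 0 < q) :
    theta2 q = q ^ ((1 : ℝ) / 4) * thetaSeries q q := by
  unfold theta2 thetaSeries
  rw [← tsum_mul_left]
  refine tsum_congr fun n => ?_
  rw [← Real.rpow_intCast, ← Real.rpow_intCast, ← Real.rpow_add hq0, ← Real.rpow_add hq0]
  congr 1
  push_cast
  ring

/-- For the modulus `k = θ₂² / θ₃²` of nome `q`, the quotient `(1 - k²) / (2 k)` is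
`∏ (1 - q ^ (2j+1)) ^ 12 / (8 √q)`. -/
lemma modulus_quotient_eq {q : ℝ} (hq0 : 0 < q) (hq1 : q < 1) :
    (1 - (theta2 q ^ 2 / theta3 q ^ 2) ^ 2) / (2 * (theta2 q ^ 2 / theta3 q ^ 2)) =
      eulerProd (-q) (q ^ 2) ^ 12 / (8 * q ^ ((1 : ℝ) / 2)) := by
  have hs0 : 0 < q ^ 2 := by positivity
  have hs1 : q ^ 2 < 1 := pow_lt_one₀ hq0.le hq1 two_ne_zero
  have hquart := thetaSeries_quartic hq0 hq1
  have hEuler := eulerProd_odd_mul_eulerProd hq0 hq1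
  have h3 := thetaSeries_eq_eulerProd hq0 hq1 one_ne_zero
  have h4 := thetaSeries_eq_eulerProd hq0 hq1 (neg_ne_zero.mpr (one_ne_zero (α := ℝ)))
  have h2 := thetaSeries_eq_eulerProd hq0 hq1 hq0.ne'
  rw [inv_mul_cancel₀ hq0.ne', eulerProd_eq_mul_shift hs0 hs1 1, one_mul, ← pow_two] at h2
  rw [inv_one, one_mul] at h3
  rw [inv_neg, inv_one, neg_one_mul] at h4
  have hR : 0 < eulerProd (-q ^ 2) (q ^ 2) := eulerProd_pos hs0 hs1 (by linarith)
  have hA : 0 < eulerProd q (q ^ 2) := eulerProd_pos hs0 hs1 (by linarith)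
  have hB : 0 < eulerProd (q ^ 2) (q ^ 2) := eulerProd_pos hs0 hs1 (by linarith)
  have hP : 0 < eulerProd (-q) (q ^ 2) := eulerProd_pos hs0 hs1 (by linarith)
  have ht : (q ^ ((1 : ℝ) / 4)) ^ 2 = q ^ ((1 : ℝ) / 2) := by
    rw [← Real.rpow_natCast, ← Real.rpow_mul hq0.le]
    norm_num
  have ht' : (q ^ ((1 : ℝ) / 2)) ^ 2 = q := by
    rw [← Real.rpow_natCast, ← Real.rpow_mul hq0.le]
    norm_num
  have hs : 0 < q ^ ((1 : ℝ) / 2) := by positivity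
  rw [theta3_eq_thetaSeries, theta2_eq_thetaSeries hq0, mul_pow, ht]
  set s := q ^ ((1 : ℝ) / 2)
  set R := eulerProd (-q ^ 2) (q ^ 2)
  set A := eulerProd q (q ^ 2)
  set B := eulerProd (q ^ 2) (q ^ 2)
  set P := eulerProd (-q) (q ^ 2)
  have hT3 : 0 < thetaSeries q 1 := by rw [h3]; positivity
  have hT2 : 0 < thetaSeries q q := by rw [h2]; positivity
  have hk : 1 - (s * thetaSeries q q ^ 2 / thetaSeries q 1 ^ 2) ^ 2 =
      thetaSeries q (-1) ^ 4 / thetaSeries q 1 ^ 4 := by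
    field_simp
    linear_combination hquart - thetaSeries q q ^ 4 * ht'
  have hAB : A * B = P⁻¹ :=
    eq_inv_of_mul_eq_one_right hEuler
  calc _ = P ^ 8 / (8 * s * (A * B) ^ 4) := by
        rw [hk, h2, h3, h4]
        field_simp
        ring
    _ = P ^ 12 / (8 * s) := by
        rw [hAB]
        field_simp

/-- Ramanujan's product formula for the g-invariant: for `r > 0`, the infinite product
over the odd positive integers `2j+1` converges and
`∏_{j=0}^∞ (1 − exp(−(2j+1)·π·√r)) = 2^(1/4)·exp(−π√r/24)·g_r`. -/
theorem ramanujan_product_formula (r : ℝ) (hr : 0 < r) :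
    Multipliable (fun j : ℕ =>
      1 - Real.exp (-((2 * (j : ℝ) + 1) * π * Real.sqrt r))) ∧
    ∏' j : ℕ, (1 - Real.exp (-((2 * (j : ℝ) + 1) * π * Real.sqrt r))) =
      (2 : ℝ) ^ ((1 : ℝ) / 4) * Real.exp (-(π * Real.sqrt r) / 24) * gRam r := by
  set q := Real.exp (-(π * Real.sqrt r)) with hq
  have hq0 : 0 < q := Real.exp_pos _
  have hq1 : q < 1 :=
    Real.exp_lt_one_iff.mpr (neg_lt_zero.mpr (mul_pos Real.pi_pos (Real.sqrt_pos.mpr hr)))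
  have hs0 : 0 < q ^ 2 := by positivity
  have hs1 : q ^ 2 < 1 := pow_lt_one₀ hq0.le hq1 two_ne_zero
  have hterm : (fun j : ℕ => 1 - Real.exp (-((2 * (j : ℝ) + 1) * π * Real.sqrt r))) =
      fun j : ℕ => 1 + -q * (q ^ 2) ^ j := by
    funext j
    rw [← pow_mul, neg_mul, ← pow_succ', ← sub_eq_add_neg, hq, ← Real.exp_nat_mul]
    congr 2
    push_cast
    ring
  have hP : 0 < eulerProd (-q) (q ^ 2) := eulerProd_pos hs0 hs1 (by linarith)
  rw [hterm]
  refine ⟨multipliable_eulerProd hs0 hs1 (-q), ?_⟩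
  change eulerProd (-q) (q ^ 2) = _
  have h8 : (8 : ℝ) ^ ((1 : ℝ) / 12) = 2 ^ ((1 : ℝ) / 4) := by
    rw [show (8 : ℝ) = 2 ^ (3 : ℝ) by norm_num, ← Real.rpow_mul zero_le_two]
    norm_num
  have hroot : (q ^ ((1 : ℝ) / 2)) ^ ((1 : ℝ) / 12) = Real.exp (-(π * Real.sqrt r) / 24) := by
    rw [← Real.rpow_mul hq0.le, hq, ← Real.exp_mul]
    congr 1
    ring
  have hpow : (eulerProd (-q) (q ^ 2) ^ 12) ^ ((1 : ℝ) / 12) = eulerProd (-q) (q ^ 2) := by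
    rw [← Real.rpow_natCast, ← Real.rpow_mul hP.le]
    norm_num
  rw [gRam, kSing, ← hq, modulus_quotient_eq hq0 hq1,
    Real.div_rpow (by positivity) (by positivity), Real.mul_rpow (by positivity) (by positivity),
    h8, hroot, hpow]
  field_simp
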